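/- arXiv:0903.1058 — 2 statements merged into one kernel-verified Lean document; each statement's English description precedes it below -/
import Mathlib

section
/- Let 0 ≤ λ < 1 and let c > -1 satisfy c ≥ λ. If f ∈ A is convex of order λ on U, then L_c f is convex of order λ on U, i.e. Re( 1 + z (L_c f)''(z)/(L_c f)'(z) ) > λ for all z ∈ U. -/
open Complex MeasureTheory intervalIntegral

noncomputable section

/-- The open unit disk `U = {z : |z| < 1}`. -/
def unitDisk : Set ℂ := Metric.ball 0 1

/-- The class `A` of normalized analytic functions on the unit disk:
`f` analytic on `U`, `f 0 = 0`, `f' 0 = 1`. -/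
def memA (f : ℂ → ℂ) : Prop :=
  DifferentiableOn ℂ f unitDisk ∧ f 0 = 0 ∧ deriv f 0 = 1

/-- The generalized Bernardi–Libera–Livingston integral operator
`(L_c f)(z) = ((c+1)/z^c) ∫₀^z t^{c-1} f t dt`, written after the substitution
`t = s z` as `(c+1) ∫₀¹ s^{c-1} f (s z) ds`. -/
def Lop (c : ℝ) (f : ℂ → ℂ) : ℂ → ℂ := fun z =>
  ((c : ℂ) + 1) * ∫ s in (0:ℝ)..1, ((s ^ (c - 1) : ℝ) : ℂ) * f ((s : ℂ) * z)

/-- The operator `I^σ`, defined via Taylor coefficients: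
`(I^σ f)(z) = z + ∑_{n≥2} (2/(n+1))^σ a_n z^n` where `a_n = f⁽ⁿ⁾(0)/n!`. -/
def Iop (σ : ℝ) (f : ℂ → ℂ) : ℂ → ℂ := fun z =>
  z + ∑' n : ℕ, (((2 / ((n : ℝ) + 3)) ^ σ : ℝ) : ℂ) *
      (iteratedDeriv (n + 2) f 0 / ((n + 2).factorial : ℂ)) * z ^ (n + 2)

/-- Starlike of order `l` : `Re (z f'(z) / f(z)) > l` on `U`. -/
def starlikeOrd (l : ℝ) (f : ℂ → ℂ) : Prop :=
  ∀ z ∈ unitDisk, l < (z * deriv f z / f z).re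

/-- Convex of order `l` : `Re (1 + z f''(z) / f'(z)) > l` on `U`. -/
def convexOrd (l : ℝ) (f : ℂ → ℂ) : Prop :=
  ∀ z ∈ unitDisk, l < (1 + z * deriv (deriv f) z / deriv f z).re

/-- Strongly starlike of order `η` and type `l` :
`|arg (z f'(z)/f(z) - l)| < π η / 2` on `U`. -/
def strongStar (η l : ℝ) (f : ℂ → ℂ) : Prop :=
  ∀ z ∈ unitDisk, |(z * deriv f z / f z - (l : ℂ)).arg| < Real.pi * η / 2

/-- Strongly convex of order `η` and type `l` :
`|arg (1 + z f''(z)/f'(z) - l)| < π η / 2` on `U`. -/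
def strongConv (η l : ℝ) (f : ℂ → ℂ) : Prop :=
  ∀ z ∈ unitDisk, |(1 + z * deriv (deriv f) z / deriv f z - (l : ℂ)).arg| < Real.pi * η / 2

/-- The class `ST_c(η, l)` : `L_c f` strongly starlike and `z (L_c f)'/(L_c f) ≠ l` on `U`. -/
def STc (c η l : ℝ) (f : ℂ → ℂ) : Prop :=
  memA f ∧ strongStar η l (Lop c f) ∧
    ∀ z ∈ unitDisk, z * deriv (Lop c f) z / Lop c f z ≠ (l : ℂ)

/-- The class `CV_c(η, l)` : `L_c f` strongly convex and `(z (L_c f)')'/(L_c f)' ≠ l` on `U`. -/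
def CVc (c η l : ℝ) (f : ℂ → ℂ) : Prop :=
  memA f ∧ strongConv η l (Lop c f) ∧
    ∀ z ∈ unitDisk,
      deriv (fun w => w * deriv (Lop c f) w) z / deriv (Lop c f) z ≠ (l : ℂ)

/-- The class `ST_σ(η, l)` : `I^σ f` strongly starlike and `z (I^σ f)'/(I^σ f) ≠ l` on `U`. -/
def STsigma (σ η l : ℝ) (f : ℂ → ℂ) : Prop :=
  memA f ∧ strongStar η l (Iop σ f) ∧
    ∀ z ∈ unitDisk, z * deriv (Iop σ f) z / Iop σ f z ≠ (l : ℂ)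

/-- The class `CV_σ(η, l)` : `I^σ f` strongly convex and `(z (I^σ f)')'/(I^σ f)' ≠ l` on `U`. -/
def CVsigma (σ η l : ℝ) (f : ℂ → ℂ) : Prop :=
  memA f ∧ strongConv η l (Iop σ f) ∧
    ∀ z ∈ unitDisk,
      deriv (fun w => w * deriv (Iop σ f) w) z / deriv (Iop σ f) z ≠ (l : ℂ)

/-- Membership in `S*(l)`. -/
def inSstar (l : ℝ) (f : ℂ → ℂ) : Prop := memA f ∧ starlikeOrd l f

/-- Membership in `C(l)`. -/
def inC (l : ℝ) (f : ℂ → ℂ) : Prop := memA f ∧ convexOrd l f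

/-- Close-to-convex of order `β` type `l` : there is `g ∈ S*(l)` with
`Re (z f'(z) / g(z)) > β` on `U`. -/
def inK (β l : ℝ) (f : ℂ → ℂ) : Prop :=
  memA f ∧ ∃ g, inSstar l g ∧ ∀ z ∈ unitDisk, β < (z * deriv f z / g z).re

/-- Quasi-convex of order `β` type `l` : there is `g ∈ C(l)` with
`Re ((z f'(z))' / g'(z)) > β` on `U`. -/
def inKstar (β l : ℝ) (f : ℂ → ℂ) : Prop :=
  memA f ∧ ∃ g, inC l g ∧
    ∀ z ∈ unitDisk, β < (deriv (fun w => w * deriv f w) z / deriv g z).re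

end


theorem aux_mem {z : ℂ} (hz : z ∈ unitDisk) {t : ℝ} (h0 : 0 ≤ t) (h1 : t ≤ 1) :
    (t : ℂ) * z ∈ unitDisk := by
  simp only [unitDisk, Metric.mem_ball, dist_zero_right, norm_mul, Complex.norm_real,
    Real.norm_eq_abs, abs_of_nonneg h0] at *
  nlinarith [norm_nonneg z]

theorem aux_open : IsOpen unitDisk := Metric.isOpen_ball

/-- a function with nonnegative radial growth does not vanish -/
theorem aux_ne_zero (H : ℂ → ℂ) (hH : DifferentiableOn ℂ H unitDisk) (h0 : H 0 = 1)
    (z : ℂ) (hz : z ∈ unitDisk)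
    (hpos : ∀ t : ℝ, 0 ≤ t → t < 1 →
      0 ≤ ((H (t * z) + (t * z) * deriv H (t * z)) * (starRingEnd ℂ) (H (t * z))).re) :
    H z ≠ 0 := by
  intro hzero
  have hd : ∀ t : ℝ, 0 ≤ t → t ≤ 1 →
      HasDerivAt (fun t : ℝ => Complex.normSq (t * H (t * z)))
        (2 * t * ((H (t * z) + (t * z) * deriv H (t * z)) * (starRingEnd ℂ) (H (t * z))).re) t := by
    intro t ht0 ht1
    have hm := aux_mem hz ht0 ht1
    have e1 : HasDerivAt H (deriv H (t * z)) (t * z) :=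
      (hH.differentiableAt (aux_open.mem_nhds hm)).hasDerivAt
    have e2 : HasDerivAt (fun t : ℝ => (t : ℂ) * z) z t := by
      simpa using (Complex.ofRealCLM.hasDerivAt (x := t)).mul_const z
    have e3 : HasDerivAt (fun t : ℝ => H (t * z)) (deriv H (t * z) * z) t :=
      HasDerivAt.comp (𝕜 := ℝ) (𝕜' := ℂ) t e1 e2
    have e4 : HasDerivAt (fun t : ℝ => (t : ℂ) * H (t * z))
        (1 * H (t * z) + t * (deriv H (t * z) * z)) t := by
      have e0 : HasDerivAt (fun t : ℝ => (t : ℂ)) 1 t :=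
        HasDerivAt.congr_deriv (Complex.ofRealCLM.hasDerivAt (x := t)) (by simp)
      exact e0.mul e3
    have e5 := Complex.reCLM.hasFDerivAt.comp_hasDerivAt t e4
    have e6 := Complex.imCLM.hasFDerivAt.comp_hasDerivAt t e4
    have e7 := (e5.mul e5).add (e6.mul e6)
    refine HasDerivAt.congr_deriv e7 ?_
    simp [Complex.mul_re, Complex.mul_im]
    ring
  have hmono : MonotoneOn (fun t : ℝ => Complex.normSq (t * H (t * z))) (Set.Icc 0 1) := by
    apply monotoneOn_of_deriv_nonneg (convex_Icc 0 1)
    · intro t ht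
      exact (hd t ht.1 ht.2).continuousAt.continuousWithinAt
    · intro t ht
      rw [interior_Icc] at ht
      exact (hd t ht.1.le ht.2.le).differentiableAt.differentiableWithinAt
    · intro t ht
      rw [interior_Icc] at ht
      rw [(hd t ht.1.le ht.2.le).deriv]
      have := hpos t ht.1.le ht.2
      have := ht.1
      positivity
  have hz0 : ∀ t : ℝ, 0 < t → t ≤ 1 → H (t * z) = 0 := by
    intro t ht0 ht1
    have := hmono ⟨ht0.le, ht1⟩ ⟨zero_le_one, le_refl _⟩ ht1
    simp only [Complex.ofReal_one, one_mul, hzero, Complex.normSq_zero] at this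
    have h2 : Complex.normSq (t * H (t * z)) = 0 := le_antisymm (by simpa using this) (Complex.normSq_nonneg _)
    rw [Complex.normSq_eq_zero] at h2
    rcases mul_eq_zero.1 h2 with h | h
    · exact absurd (by exact_mod_cast h) ht0.ne'
    · exact h
  have hcont : ContinuousAt (fun t : ℝ => H (t * z)) 0 := by
    have : ContinuousAt H (((0:ℝ):ℂ) * z) :=
      (hH.differentiableAt (aux_open.mem_nhds (aux_mem hz le_rfl zero_le_one))).continuousAt
    exact ContinuousAt.comp (f := fun t : ℝ => (t : ℂ) * z) this (by fun_prop)
  have hne : ∀ᶠ t : ℝ in nhds 0, H (t * z) ≠ 0 := by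
    apply hcont.eventually_ne
    simp [h0]
  obtain ⟨ε, hε, hb⟩ := Metric.eventually_nhds_iff.1 hne
  have hp : 0 < min (ε / 2) 1 := by positivity
  refine hb (y := min (ε / 2) 1) ?_ (hz0 _ hp (min_le_right _ _))
  rw [Real.dist_eq, sub_zero, abs_of_pos hp]
  linarith [min_le_left (ε / 2) 1]

/-- Boundary derivative lemma. -/
theorem aux_bdry (p : ℂ → ℂ) (p' z : ℂ) (hz : z ≠ 0) (lam : ℝ) (hp : HasDerivAt p p' z)
    (h0 : (p z).re ≤ lam) (h : ∀ w : ℂ, ‖w‖ < ‖z‖ → lam ≤ (p w).re) :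
    (z * p').im = 0 ∧ (z * p').re ≤ 0 := by
  have key : ∀ v : ℂ, v.re < 0 → 0 ≤ (z * p' * v).re := by
    intro v hv
    have e2 : HasDerivAt (fun t : ℝ => z * (1 + (t : ℂ) * v)) (z * v) 0 := by
      have := (((Complex.ofRealCLM.hasDerivAt (x := (0:ℝ))).mul_const v).const_add 1).const_mul z
      simpa using this
    have e1 : HasDerivAt p p' (z * (1 + ((0:ℝ) : ℂ) * v)) := by simpa using hp
    have e3 : HasDerivAt (fun t : ℝ => p (z * (1 + (t : ℂ) * v))) (p' * (z * v)) 0 :=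
      HasDerivAt.comp (𝕜 := ℝ) (𝕜' := ℂ) 0 e1 e2
    have e4 : HasDerivAt (fun t : ℝ => (p (z * (1 + (t : ℂ) * v))).re) ((p' * (z * v)).re) 0 := by
      exact Complex.reCLM.hasFDerivAt.comp_hasDerivAt 0 e3
    have e5 := (hasDerivAt_iff_tendsto_slope.1 e4).mono_left
      (nhdsWithin_mono (0:ℝ) (fun x (hx : x ∈ Set.Ioi (0:ℝ)) => ne_of_gt hx))
    have : (z * p' * v).re = (p' * (z * v)).re := by ring_nf
    rw [this]
    refine ge_of_tendsto e5 ?_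
    have hn : 0 < Complex.normSq v := by
      rw [Complex.normSq_pos]; rintro rfl; simp at hv
    have hδ : 0 < -v.re / Complex.normSq v := div_pos (by linarith) hn
    filter_upwards [Ioo_mem_nhdsGT hδ] with t ht
    rw [slope_def_field]
    apply div_nonneg _ (by linarith [ht.1])
    have hlt : ‖z * (1 + (t : ℂ) * v)‖ < ‖z‖ := by
      rw [norm_mul]
      have : ‖1 + (t : ℂ) * v‖ < 1 := by
        rw [← sq_lt_one_iff₀ (norm_nonneg _), ← Complex.normSq_eq_norm_sq, Complex.normSq_apply]
        have h1 := (lt_div_iff₀ hn).1 ht.2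
        rw [Complex.normSq_apply] at h1
        simp
        nlinarith [ht.1]
      have := norm_pos_iff.2 hz
      nlinarith
    have := h _ hlt
    simp
    linarith
  set a := z * p' with ha
  have hre : ∀ δ : ℝ, 0 < δ → |a.im| ≤ -δ * a.re := by
    intro δ hδ
    have h1 := key ⟨-δ, 1⟩ (by simpa using hδ)
    have h2 := key ⟨-δ, -1⟩ (by simpa using hδ)
    simp [Complex.mul_re] at h1 h2
    rw [abs_le]; constructor <;> nlinarith
  have hr : a.re ≤ 0 := by
    have := hre 1 one_pos
    linarith [abs_nonneg a.im]
  refine ⟨?_, hr⟩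
  by_contra hne
  have hpos : 0 < |a.im| := abs_pos.2 hne
  have := hre (|a.im| / (2 * (1 - a.re))) (by apply div_pos hpos; linarith)
  have h3 : -(|a.im| / (2 * (1 - a.re))) * a.re ≤ |a.im| / 2 := by
    rw [neg_mul, ← mul_neg, div_mul_eq_mul_div, div_le_div_iff₀ (by linarith) two_pos]
    nlinarith
  linarith

theorem aux_core (c lam : ℝ) (hlam0 : 0 ≤ lam) (hlam1 : lam < 1) (hclam : lam ≤ c)
    (g G : ℂ → ℂ) (hg : DifferentiableOn ℂ g unitDisk) (hG : DifferentiableOn ℂ G unitDisk)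
    (hg0 : g 0 = 1) (hG0 : G 0 = 1)
    (hode : ∀ z ∈ unitDisk, z * deriv G z + (c + 1) * G z = (c + 1) * g z)
    (hconv : ∀ z ∈ unitDisk, lam < (1 + z * deriv g z / g z).re) :
    ∀ z ∈ unitDisk, lam < (1 + z * deriv G z / G z).re := by
  have hident : ∀ a b : ℂ, a ≠ 0 →
      ((a + b) * (starRingEnd ℂ) a).re = Complex.normSq a * (1 + b / a).re := by
    intro a b ha
    rw [← Complex.re_ofReal_mul, Complex.normSq_eq_conj_mul_self]
    congr 1
    field_simp
  have hgne : ∀ z ∈ unitDisk, g z ≠ 0 := by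
    intro z hz
    refine aux_ne_zero g hg hg0 z hz ?_
    intro t ht0 ht1
    by_cases h : g (t * z) = 0
    · simp [h]
    · rw [hident _ _ h]
      have := hconv _ (aux_mem hz ht0 ht1.le)
      exact mul_nonneg (Complex.normSq_nonneg _) (by linarith)
  intro z1 hz1
  by_contra hcon
  push Not at hcon
  have hG1 : G z1 ≠ 0 := by
    intro h
    simp [h] at hcon
    linarith
  set φ : ℂ → ℝ := fun z => ((G z + z * deriv G z) * (starRingEnd ℂ) (G z)).re
    - lam * Complex.normSq (G z) with hφ
  have hsub : Metric.closedBall (0:ℂ) ‖z1‖ ⊆ unitDisk := by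
    apply Metric.closedBall_subset_ball
    simpa [unitDisk] using hz1
  have hG'c : ContinuousOn (deriv G) unitDisk := (hG.deriv aux_open).continuousOn
  have hφc : ContinuousOn φ (Metric.closedBall (0:ℂ) ‖z1‖) := by
    have h1 := hG.continuousOn.mono hsub
    have h2 := hG'c.mono hsub
    have h3 : ContinuousOn (fun z => (starRingEnd ℂ) (G z)) (Metric.closedBall (0:ℂ) ‖z1‖) :=
      Complex.continuous_conj.comp_continuousOn h1
    have h4 : ContinuousOn (fun z => Complex.normSq (G z)) (Metric.closedBall (0:ℂ) ‖z1‖) :=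
      Complex.continuous_normSq.comp_continuousOn h1
    apply ContinuousOn.sub
    · exact Complex.continuous_re.comp_continuousOn ((h1.add (continuousOn_id.mul h2)).mul h3)
    · exact continuousOn_const.mul h4
  have hφG : ∀ z, G z ≠ 0 →
      φ z = Complex.normSq (G z) * ((1 + z * deriv G z / G z).re - lam) := by
    intro z hz
    simp only [hφ]
    rw [hident _ _ hz]; ring
  have hKc : IsCompact (Metric.closedBall (0:ℂ) ‖z1‖ ∩ φ ⁻¹' Set.Iic 0) := by
    apply (isCompact_closedBall (0:ℂ) ‖z1‖).of_isClosed_subset _ Set.inter_subset_left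
    exact hφc.preimage_isClosed_of_isClosed Metric.isClosed_closedBall isClosed_Iic
  have hKn : (Metric.closedBall (0:ℂ) ‖z1‖ ∩ φ ⁻¹' Set.Iic 0).Nonempty := by
    refine ⟨z1, by simp, ?_⟩
    simp only [Set.mem_preimage, Set.mem_Iic]
    rw [hφG _ hG1]
    exact mul_nonpos_of_nonneg_of_nonpos (Complex.normSq_nonneg _) (by linarith)
  obtain ⟨z0, ⟨hz0b, hz0φ⟩, hmin⟩ := hKc.exists_isMinOn hKn continuous_norm.continuousOn
  simp only [Set.mem_preimage, Set.mem_Iic] at hz0φ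
  have hz0 : z0 ∈ unitDisk := hsub hz0b
  have hinner : ∀ w : ℂ, ‖w‖ < ‖z0‖ → 0 < φ w := by
    intro w hw
    by_contra hle
    have hb : w ∈ Metric.closedBall (0:ℂ) ‖z1‖ := by
      simp at hz0b ⊢; linarith
    have := hmin (show w ∈ _ from ⟨hb, not_lt.1 hle⟩)
    simp at this
    linarith
  have hz0ne : z0 ≠ 0 := by
    rintro rfl
    simp [hφ, hG0] at hz0φ
    linarith
  have hGz0 : G z0 ≠ 0 := by
    refine aux_ne_zero G hG hG0 z0 hz0 ?_
    intro t ht0 ht1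
    have := hinner (t * z0) (by
      rw [norm_mul, Complex.norm_real, Real.norm_eq_abs, abs_of_nonneg ht0]
      have := norm_pos_iff.2 hz0ne
      nlinarith)
    simp only [hφ] at this
    have h2 := mul_nonneg hlam0 (Complex.normSq_nonneg (G (t * z0)))
    linarith
  set p : ℂ → ℂ := fun z => (c + 1) * (g z / G z) - c with hp
  have hpe : ∀ z ∈ unitDisk, G z ≠ 0 → 1 + z * deriv G z / G z = p z := by
    intro z hz hne
    have := hode z hz
    simp only [hp]
    field_simp
    linear_combination this
  have hre : ∀ z ∈ unitDisk, G z ≠ 0 → φ z = Complex.normSq (G z) * ((p z).re - lam) := by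
    intro z hz hne
    rw [hφG z hne, hpe z hz hne]
  have hder : HasDerivAt p ((c + 1) * ((deriv g z0 * G z0 - g z0 * deriv G z0) / G z0 ^ 2)) z0 := by
    have e1 := (hg.differentiableAt (aux_open.mem_nhds hz0)).hasDerivAt
    have e2 := (hG.differentiableAt (aux_open.mem_nhds hz0)).hasDerivAt
    exact ((e1.div e2 hGz0).const_mul _).sub_const _
  have hb := aux_bdry p _ z0 hz0ne lam hder
    (by
      rw [hre z0 hz0 hGz0] at hz0φ
      have := Complex.normSq_pos.2 hGz0
      by_contra h
      push Not at h
      have := mul_pos this (sub_pos.2 h)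
      linarith)
    (by
      intro w hw
      have h1 := hinner w hw
      have hwd : w ∈ unitDisk := by
        simp [unitDisk] at hz0 ⊢; linarith
      have hne : G w ≠ 0 := by
        intro h
        simp [hφ, h] at h1
      rw [hre w hwd hne] at h1
      have := Complex.normSq_pos.2 hne
      by_contra h
      push Not at h
      nlinarith)
  have hp0 : (p z0).re ≤ lam := by
    rw [hre z0 hz0 hGz0] at hz0φ
    have := Complex.normSq_pos.2 hGz0
    by_contra h
    push Not at h
    have := mul_pos this (sub_pos.2 h)
    linarith
  have hp1 : lam ≤ (p z0).re := by
    -- by continuity along the radius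
    have hcont : ContinuousAt (fun t : ℝ => (p (t * z0)).re) 1 := by
      have h1 : ContinuousAt p (((1:ℝ):ℂ) * z0) := by simpa using hder.continuousAt
      have h2 : ContinuousAt (fun t : ℝ => p (t * z0)) 1 :=
        ContinuousAt.comp (f := fun t : ℝ => (t : ℂ) * z0) h1 (by fun_prop)
      exact Complex.continuous_re.continuousAt.comp h2
    have ht : Filter.Tendsto (fun t : ℝ => (p (t * z0)).re) (nhdsWithin 1 (Set.Iio 1))
        (nhds ((p z0).re)) := by
      have := hcont.tendsto.mono_left (nhdsWithin_le_nhds (s := Set.Iio (1:ℝ)))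
      simpa using this
    refine ge_of_tendsto ht ?_
    filter_upwards [Ioo_mem_nhdsLT (show (0:ℝ) < 1 by norm_num)] with t ht
    have hw : ‖(t : ℂ) * z0‖ < ‖z0‖ := by
      rw [norm_mul, Complex.norm_real, Real.norm_eq_abs, abs_of_pos ht.1]
      have := norm_pos_iff.2 hz0ne
      nlinarith [ht.2]
    have h1 := hinner _ hw
    have hwd := aux_mem hz0 ht.1.le ht.2.le
    have hne : G (t * z0) ≠ 0 := by
      intro h
      simp [hφ, h] at h1
    rw [hre _ hwd hne] at h1
    have := Complex.normSq_pos.2 hne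
    by_contra h
    push Not at h
    nlinarith
  set a := z0 * ((c + 1) * ((deriv g z0 * G z0 - g z0 * deriv G z0) / G z0 ^ 2)) with ha
  have hgz0 := hgne z0 hz0
  have hc1 : (c : ℂ) + 1 ≠ 0 := by
    have : (c + 1 : ℝ) ≠ 0 := by linarith
    exact_mod_cast this
  have hq : 1 + z0 * deriv g z0 / g z0 = p z0 + a * (p z0 + c)⁻¹ := by
    have h1 : p z0 + c = (c + 1) * (g z0 / G z0) := by simp [hp]
    rw [h1, ← hpe z0 hz0 hGz0, ha]
    field_simp
    ring
  have hfin := hconv z0 hz0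
  have har : a = (a.re : ℂ) := by
    apply Complex.ext <;> simp [hb.1]
  rw [hq, har, Complex.add_re, Complex.re_ofReal_mul, Complex.inv_re] at hfin
  have h5 : 0 ≤ (p z0 + c).re / Complex.normSq (p z0 + c) := by
    apply div_nonneg _ (Complex.normSq_nonneg _)
    simp; linarith
  have := mul_nonpos_of_nonpos_of_nonneg hb.2 h5
  linarith

/-- The averaged function. -/
theorem aux_avg (c : ℝ) (hc : 0 ≤ c) (h : ℂ → ℂ) (hh : DifferentiableOn ℂ h unitDisk)
    (z : ℂ) (hz : z ∈ unitDisk) :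
    ∃ m : ℂ, HasDerivAt (fun w => ∫ s in (0:ℝ)..1, ((s ^ c : ℝ) : ℂ) * h (s * w)) m z ∧
      z * m + (c + 1) * (∫ s in (0:ℝ)..1, ((s ^ c : ℝ) : ℂ) * h (s * z)) = h z := by
  have hh' : DifferentiableOn ℂ (deriv h) unitDisk := hh.deriv aux_open
  have hz' : ‖z‖ < 1 := by simpa [unitDisk] using hz
  set r := (1 - ‖z‖) / 2 with hr
  have hrpos : 0 < r := by simp only [hr]; linarith
  have hsub : Metric.closedBall (0:ℂ) (‖z‖ + r) ⊆ unitDisk :=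
    Metric.closedBall_subset_ball (by simp only [hr]; linarith)
  obtain ⟨B, hB⟩ := (isCompact_closedBall (0:ℂ) (‖z‖ + r)).exists_bound_of_continuousOn
    (hh'.continuousOn.mono hsub)
  have hball : ∀ w ∈ Metric.ball z r, ∀ s : ℝ, 0 ≤ s → s ≤ 1 →
      (s : ℂ) * w ∈ Metric.closedBall (0:ℂ) (‖z‖ + r) := by
    intro w hw s hs0 hs1
    simp only [Metric.mem_closedBall, dist_zero_right, norm_mul, Complex.norm_real,
      Real.norm_eq_abs, abs_of_nonneg hs0]
    have h1 : ‖w‖ ≤ ‖z‖ + r := by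
      have := norm_le_norm_add_norm_sub' w z
      rw [Metric.mem_ball, dist_eq_norm] at hw
      linarith
    nlinarith [norm_nonneg w]
  have hrc : Continuous (fun s : ℝ => ((s ^ c : ℝ) : ℂ)) :=
    Complex.continuous_ofReal.comp (Real.continuous_rpow_const hc)
  have hcomp : ∀ (k : ℂ → ℂ), ContinuousOn k unitDisk → ∀ w ∈ Metric.ball z r,
      ContinuousOn (fun s : ℝ => k (s * w)) (Set.Icc 0 1) := by
    intro k hk w hw
    refine hk.comp (f := fun s : ℝ => (s : ℂ) * w) (by fun_prop) ?_
    intro s hs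
    exact hsub (hball w hw s hs.1 hs.2)
  have hzb : z ∈ Metric.ball z r := Metric.mem_ball_self hrpos
  have hF : ∀ w ∈ Metric.ball z r,
      ContinuousOn (fun s : ℝ => ((s ^ c : ℝ) : ℂ) * h (s * w)) (Set.Icc 0 1) := fun w hw =>
    hrc.continuousOn.mul (hcomp h hh.continuousOn w hw)
  have hF' : ContinuousOn (fun s : ℝ => ((s ^ c : ℝ) : ℂ) * (deriv h (s * z) * s)) (Set.Icc 0 1) :=
    hrc.continuousOn.mul ((hcomp _ hh'.continuousOn z hzb).mul
      Complex.continuous_ofReal.continuousOn)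
  have huI : Set.uIoc (0:ℝ) 1 = Set.Ioc 0 1 := Set.uIoc_of_le zero_le_one
  have hmeas : ∀ k : ℝ → ℂ, ContinuousOn k (Set.Icc 0 1) →
      AEStronglyMeasurable k (volume.restrict (Set.uIoc (0:ℝ) 1)) := by
    intro k hk
    rw [huI]
    exact (hk.mono Set.Ioc_subset_Icc_self).aestronglyMeasurable measurableSet_Ioc
  have hint : ∀ k : ℝ → ℂ, ContinuousOn k (Set.Icc 0 1) →
      IntervalIntegrable k volume 0 1 := by
    intro k hk
    apply ContinuousOn.intervalIntegrable
    rwa [Set.uIcc_of_le zero_le_one]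
  have hD := (intervalIntegral.hasDerivAt_integral_of_dominated_loc_of_deriv_le
    (μ := volume) (a := (0:ℝ)) (b := 1)
    (F := fun (w : ℂ) (s : ℝ) => ((s ^ c : ℝ) : ℂ) * h (s * w))
    (F' := fun (w : ℂ) (s : ℝ) => ((s ^ c : ℝ) : ℂ) * (deriv h (s * w) * s))
    (x₀ := z) (s := Metric.ball z r) (bound := fun _ => B)
    (Metric.ball_mem_nhds z hrpos)
    (by
      filter_upwards [Metric.ball_mem_nhds z hrpos] with w hw
      exact hmeas _ (hF w hw))
    (hint _ (hF z hzb))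
    (hmeas _ hF')
    (by
      refine Filter.Eventually.of_forall ?_
      intro s hs w hw
      rw [huI] at hs
      have h1 := hB _ (hball w hw s hs.1.le hs.2)
      have h2 : s ^ c ≤ 1 := Real.rpow_le_one hs.1.le hs.2 hc
      have h3 : 0 ≤ s ^ c := Real.rpow_nonneg hs.1.le c
      rw [norm_mul, norm_mul, Complex.norm_real, Complex.norm_real, Real.norm_eq_abs,
        Real.norm_eq_abs, abs_of_nonneg h3, abs_of_pos hs.1]
      have h4 : ‖deriv h (s * w)‖ * s ≤ B := by
        nlinarith [norm_nonneg (deriv h (s * w)), hs.1, hs.2]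
      have h5 : 0 ≤ ‖deriv h (s * w)‖ * s := mul_nonneg (norm_nonneg _) hs.1.le
      nlinarith)
    intervalIntegrable_const
    (by
      refine Filter.Eventually.of_forall ?_
      intro s hs w hw
      rw [huI] at hs
      have e1 : HasDerivAt h (deriv h (s * w)) (s * w) :=
        (hh.differentiableAt (aux_open.mem_nhds (hsub (hball w hw s hs.1.le hs.2)))).hasDerivAt
      have e2 : HasDerivAt (fun w : ℂ => (s : ℂ) * w) (s : ℂ) w := by
        simpa using (hasDerivAt_id w).const_mul (s : ℂ)
      exact (HasDerivAt.comp w e1 e2).const_mul _)).2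
  refine ⟨_, hD, ?_⟩
  rw [← intervalIntegral.integral_const_mul, ← intervalIntegral.integral_const_mul,
    ← intervalIntegral.integral_add ((hint _ hF').const_mul z) ((hint _ (hF z hzb)).const_mul _)]
  have hfc : Continuous (fun s : ℝ => ((s ^ (c + 1) : ℝ) : ℂ)) :=
    Complex.continuous_ofReal.comp (Real.continuous_rpow_const (by linarith))
  have := intervalIntegral.integral_eq_sub_of_hasDerivAt_of_le (a := (0:ℝ)) (b := 1) zero_le_one
    (f := fun s : ℝ => ((s ^ (c + 1) : ℝ) : ℂ) * h (s * z))
    (f' := fun s : ℝ => z * (((s ^ c : ℝ) : ℂ) * (deriv h (s * z) * s))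
      + (c + 1) * (((s ^ c : ℝ) : ℂ) * h (s * z)))
    (hfc.continuousOn.mul (hcomp h hh.continuousOn z hzb))
    (by
      intro s hs
      have e1 : HasDerivAt h (deriv h (s * z)) (s * z) :=
        (hh.differentiableAt (aux_open.mem_nhds (hsub (hball z hzb s hs.1.le hs.2.le)))).hasDerivAt
      have e2 : HasDerivAt (fun t : ℝ => (t : ℂ) * z) z s := by
        simpa using (Complex.ofRealCLM.hasDerivAt (x := s)).mul_const z
      have e3 : HasDerivAt (fun t : ℝ => h (t * z)) (deriv h (s * z) * z) s :=
        HasDerivAt.comp (𝕜 := ℝ) (𝕜' := ℂ) s e1 e2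
      have e4 : HasDerivAt (fun t : ℝ => ((t ^ (c + 1) : ℝ) : ℂ))
          ((((c + 1) * s ^ c : ℝ)) : ℂ) s := by
        have := Real.hasDerivAt_rpow_const (x := s) (p := c + 1) (Or.inl hs.1.ne')
        simpa using this.ofReal_comp
      refine HasDerivAt.congr_deriv (e4.mul e3) ?_
      rw [Real.rpow_add hs.1, Real.rpow_one]
      push_cast
      ring)
    (((hint _ hF').const_mul z).add ((hint _ (hF z hzb)).const_mul _))
  rw [this]
  have hne : c + 1 ≠ 0 := by linarith
  simp [Real.zero_rpow hne]

theorem convex_implies_Lop_convex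
    (c lam : ℝ) (hc : -1 < c) (hlam0 : 0 ≤ lam) (hlam1 : lam < 1)
    (hclam : lam ≤ c)
    (f : ℂ → ℂ) (hf : memA f) (hconv : convexOrd lam f) :
    convexOrd lam (Lop c f) := by
  obtain ⟨hfd, hf0, hf1⟩ := hf
  have hc0 : 0 ≤ c := hlam0.trans hclam
  have hc1 : (c : ℂ) + 1 ≠ 0 := by
    have : (c + 1 : ℝ) ≠ 0 := by linarith
    exact_mod_cast this
  have h0m : (0:ℂ) ∈ unitDisk := by simp [unitDisk]
  set h : ℂ → ℂ := dslope f 0 with hh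
  have hhd : DifferentiableOn ℂ h unitDisk :=
    (Complex.differentiableOn_dslope (aux_open.mem_nhds h0m)).2 hfd
  have hfh : ∀ w, f w = w * h w := by
    intro w
    have := sub_smul_dslope f 0 w
    simp [hf0] at this
    exact this.symm
  have hh0 : h 0 = 1 := by simp [hh, dslope_same, hf1]
  set M : ℂ → ℂ := fun w => ∫ s in (0:ℝ)..1, ((s ^ c : ℝ) : ℂ) * h (s * w) with hM
  have hMd : ∀ z ∈ unitDisk, HasDerivAt M (deriv M z) z ∧
      z * deriv M z + (c + 1) * M z = h z := by
    intro z hz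
    obtain ⟨m, hm1, hm2⟩ := aux_avg c hc0 h hhd z hz
    have : deriv M z = m := hm1.deriv
    rw [this]
    exact ⟨hm1, hm2⟩
  have hL : Lop c f = fun z => (c + 1) * (z * M z) := by
    funext z
    simp only [Lop, hM]
    congr 1
    rw [← intervalIntegral.integral_const_mul]
    apply intervalIntegral.integral_congr_ae
    refine Filter.Eventually.of_forall ?_
    intro s hs
    rw [Set.uIoc_of_le zero_le_one] at hs
    have : s ^ c = s ^ (c - 1) * s := by
      rw [← Real.rpow_add_one hs.1.ne']; ring_nf
    rw [hfh, this]
    push_cast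
    ring
  set G : ℂ → ℂ := fun z => (c + 1) * (h z - c * M z) with hG
  have hLd : ∀ z ∈ unitDisk, deriv (Lop c f) z = G z := by
    intro z hz
    obtain ⟨e1, e2⟩ := hMd z hz
    rw [hL]
    have := (((hasDerivAt_id z).mul e1).const_mul ((c:ℂ) + 1)).deriv
    refine Eq.trans this ?_
    simp only [hG, id]
    linear_combination ((c:ℂ)+1) * e2
  have hGder : ∀ z ∈ unitDisk, HasDerivAt G ((c + 1) * (deriv h z - c * deriv M z)) z := by
    intro z hz
    have e3 := (hhd.differentiableAt (aux_open.mem_nhds hz)).hasDerivAt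
    exact (e3.sub ((hMd z hz).1.const_mul _)).const_mul _
  have hfder : ∀ z ∈ unitDisk, deriv f z = h z + z * deriv h z := by
    intro z hz
    have e3 := (hhd.differentiableAt (aux_open.mem_nhds hz)).hasDerivAt
    have : f = fun w => w * h w := funext hfh
    rw [this]
    refine Eq.trans ((hasDerivAt_id z).mul e3).deriv ?_
    simp
  have hG0 : G 0 = 1 := by
    have := (hMd 0 h0m).2
    rw [hh0] at this
    simp only [hG, hh0]
    linear_combination (-(c:ℂ)) * this
  have hres := aux_core c lam hlam0 hlam1 hclam (deriv f) G (hfd.deriv aux_open)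
    (fun z hz => (hGder z hz).differentiableAt.differentiableWithinAt) hf1 hG0
    (by
      intro z hz
      rw [(hGder z hz).deriv, hfder z hz]
      simp only [hG]
      linear_combination (-(c:ℂ)) * (c + 1) * (hMd z hz).2)
    hconv
  intro z hz
  have hev : deriv (Lop c f) =ᶠ[nhds z] G := by
    filter_upwards [aux_open.mem_nhds hz] with w hw using hLd w hw
  rw [hev.deriv_eq, hLd z hz]
  exact hres z hz
end

section
/- Let 0 ≤ λ < 1, 0 < η ≤ 1, let σ be a real number, and let c > -1 satisfy c ≥ λ. Let f ∈ A satisfy (z (L_c(I^σ f))'(z))'/(L_c(I^σ f))'(z) ≠ λ for all z ∈ U. If f ∈ CV_σ(η,λ), then I^σ f ∈ CV_c(η,λ); in particular |arg( 1 + z (L_c(I^σ f))''(z)/(L_c(I^σ f))'(z) − λ )| < πη/2 for all z ∈ U. -/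
open Complex MeasureTheory intervalIntegral

open scoped Topology ComplexConjugate

lemma first_bad (u : ℂ → ℝ) (hu : ContinuousOn u unitDisk) (h0 : 0 < u 0)
    (H : ∀ z0 ∈ unitDisk, z0 ≠ 0 → (∀ z, ‖z‖ < ‖z0‖ → 0 < u z) → u z0 = 0 →
      (∀ z, ‖z‖ ≤ ‖z0‖ → 0 ≤ u z) → False) : ∀ z ∈ unitDisk, 0 < u z := by
  intro z1 hz1
  by_contra hneg
  push Not at hneg
  have hz1' : ‖z1‖ < 1 := by simpa [unitDisk] using hz1
  have hsub : Metric.closedBall (0:ℂ) ‖z1‖ ⊆ unitDisk := by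
    intro z hz
    simp [unitDisk] at hz ⊢
    linarith
  have hcl : IsClosed (Metric.closedBall (0:ℂ) ‖z1‖ ∩ u ⁻¹' Set.Iic 0) :=
    (hu.mono hsub).preimage_isClosed_of_isClosed Metric.isClosed_closedBall isClosed_Iic
  have hcp : IsCompact (Metric.closedBall (0:ℂ) ‖z1‖ ∩ u ⁻¹' Set.Iic 0) :=
    (isCompact_closedBall (0:ℂ) ‖z1‖).of_isClosed_subset hcl Set.inter_subset_left
  obtain ⟨z0, ⟨hz0b, hz0u⟩, hmin⟩ := hcp.exists_isMinOn ⟨z1, by simp, hneg⟩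
    (continuous_norm.continuousOn)
  have hz0b' : ‖z0‖ ≤ ‖z1‖ := by simpa using hz0b
  have hz0u' : u z0 ≤ 0 := hz0u
  have hpos : ∀ z, ‖z‖ < ‖z0‖ → 0 < u z := by
    intro z hz
    by_contra hc
    push Not at hc
    have : ‖z0‖ ≤ ‖z‖ := hmin ⟨by simp; linarith, hc⟩
    linarith
  have hz0n : z0 ≠ 0 := by
    rintro rfl
    linarith
  have hnn : ∀ z, ‖z‖ ≤ ‖z0‖ → 0 ≤ u z := by
    intro z hz
    have hzU : z ∈ unitDisk := by simp [unitDisk]; linarith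
    have hca : ContinuousAt u z := hu.continuousAt (Metric.isOpen_ball.mem_nhds hzU)
    have ht : Filter.Tendsto (fun t : ℝ => (t:ℂ) * z) (𝓝[<] 1) (𝓝 z) := by
      have : Continuous (fun t : ℝ => (t:ℂ) * z) := by fun_prop
      have h1 := this.tendsto 1
      simp only [ofReal_one, one_mul] at h1
      exact h1.mono_left nhdsWithin_le_nhds
    refine ge_of_tendsto (hca.tendsto.comp ht) ?_
    have hI : Set.Ioo (0:ℝ) 1 ∈ 𝓝[<] (1:ℝ) := Ioo_mem_nhdsLT (by norm_num)
    filter_upwards [hI] with t ht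
    refine (hpos _ ?_).le
    rw [norm_mul, norm_real, Real.norm_of_nonneg ht.1.le]
    have := norm_pos_iff.2 hz0n
    by_cases hz' : ‖z‖ = 0
    · rw [hz']; simpa using this
    · have : 0 < ‖z‖ := lt_of_le_of_ne (norm_nonneg _) (Ne.symm hz')
      nlinarith [ht.2]
  exact H z0 (hsub hz0b) hz0n hpos (le_antisymm hz0u' (hnn z0 le_rfl)) hnn

lemma touch (q : ℂ → ℂ) (q' z0 : ℂ) (hq : HasDerivAt q q' z0)
    (h : ∀ᶠ z in 𝓝 z0, ‖z‖ ≤ ‖z0‖ → 0 ≤ (q z).re) (h0 : (q z0).re = 0) :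
    (z0 * q').im = 0 ∧ (z0 * q').re ≤ 0 := by
  constructor
  · have hinner : HasDerivAt (fun t : ℝ => z0 * cexp ((t:ℂ) * I)) (z0 * I) 0 := by
      have h1 : HasDerivAt (fun t : ℂ => z0 * cexp (t * I)) (z0 * (cexp ((0:ℂ) * I) * (1 * I))) (0:ℂ) :=
        (((hasDerivAt_id (0:ℂ)).mul_const I).cexp).const_mul z0
      have h2 := HasDerivAt.comp_ofReal (z := (0:ℝ)) (by simpa using h1)
      simpa using h2
    have hv : z0 * cexp (((0:ℝ):ℂ) * I) = z0 := by simp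
    have hcomp : HasDerivAt (fun t : ℝ => q (z0 * cexp ((t:ℂ) * I))) (q' * (z0 * I)) 0 :=
      HasDerivAt.comp (h₂ := q) (0:ℝ) (by rw [hv]; exact hq) hinner
    have hre : HasDerivAt (fun t : ℝ => (q (z0 * cexp ((t:ℂ) * I))).re) ((q' * (z0 * I)).re) 0 :=
      (reCLM.hasFDerivAt.comp_hasDerivAt (0:ℝ) hcomp)
    have hmin : IsLocalMin (fun t : ℝ => (q (z0 * cexp ((t:ℂ) * I))).re) 0 := by
      have ht : Filter.Tendsto (fun t : ℝ => z0 * cexp ((t:ℂ) * I)) (𝓝 0) (𝓝 z0) := by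
        have := hinner.continuousAt.tendsto
        rwa [hv] at this
      filter_upwards [ht.eventually h] with t ht
      simp only [hv, h0]
      exact ht (by simp [norm_exp_ofReal_mul_I])
    have := hmin.hasDerivAt_eq_zero hre
    simp at this ⊢
    linarith
  · by_contra hpos
    push Not at hpos
    have hinner : HasDerivAt (fun t : ℝ => (t:ℂ) * z0) z0 1 := by
      have h1 : HasDerivAt (fun t : ℂ => t * z0) (1 * z0) ((1:ℝ):ℂ) :=
        (hasDerivAt_id _).mul_const z0
      simpa using HasDerivAt.comp_ofReal (z := (1:ℝ)) h1
    have hv : ((1:ℝ):ℂ) * z0 = z0 := by simp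
    have hcomp : HasDerivAt (fun t : ℝ => q ((t:ℂ) * z0)) (q' * z0) 1 :=
      HasDerivAt.comp (h₂ := q) (1:ℝ) (by rw [hv]; exact hq) hinner
    have hre : HasDerivAt (fun t : ℝ => (q ((t:ℂ) * z0)).re) ((q' * z0).re) 1 :=
      (reCLM.hasFDerivAt.comp_hasDerivAt (1:ℝ) hcomp)
    have hs := hre.tendsto_slope
    have hs' : Filter.Tendsto (slope (fun t : ℝ => (q ((t:ℂ) * z0)).re) 1) (𝓝[<] 1)
        (𝓝 ((q' * z0).re)) := hs.mono_left (nhdsWithin_mono _ (by intro x hx; exact ne_of_lt hx))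
    have hle : (q' * z0).re ≤ 0 := by
      refine le_of_tendsto hs' ?_
      have ht : Filter.Tendsto (fun t : ℝ => (t:ℂ) * z0) (𝓝[<] 1) (𝓝 z0) := by
        have := hinner.continuousAt.tendsto
        rw [hv] at this
        exact this.mono_left nhdsWithin_le_nhds
      have hI : Set.Ioo (0:ℝ) 1 ∈ 𝓝[<] (1:ℝ) := Ioo_mem_nhdsLT (by norm_num)
      filter_upwards [ht.eventually h, hI] with t ht hI
      have h3 := ht (by
        rw [norm_mul, norm_real, Real.norm_of_nonneg hI.1.le]
        nlinarith [norm_nonneg z0, hI.2])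
      rw [slope_def_field]
      simp only [hv, h0, sub_zero]
      exact div_nonpos_of_nonneg_of_nonpos h3 (by linarith [hI.2])
    rw [mul_comm] at hle
    linarith

lemma ray (g : ℂ → ℂ) (hg : DifferentiableOn ℂ g unitDisk) (h0 : g 0 ≠ 0) (z0 : ℂ)
    (hz0 : z0 ∈ unitDisk)
    (h : ∀ t : ℝ, 0 < t → t < 1 → 0 ≤ (1 + (t * z0) * deriv g (t * z0) / g (t * z0)).re) :
    g z0 ≠ 0 := by
  intro hgz
  have hz0' : ‖z0‖ < 1 := by simpa [unitDisk] using hz0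
  have hmem : ∀ t : ℝ, 0 ≤ t → t ≤ 1 → (t:ℂ) * z0 ∈ unitDisk := by
    intro t h1 h2
    simp only [unitDisk, mem_ball_zero_iff, norm_mul, norm_real, Real.norm_of_nonneg h1]
    nlinarith [norm_nonneg z0]
  have hinner : ∀ t : ℝ, HasDerivAt (fun t : ℝ => (t:ℂ) * z0) z0 t := by
    intro t
    have h1 : HasDerivAt (fun t : ℂ => t * z0) (1 * z0) (t:ℂ) :=
      (hasDerivAt_id _).mul_const z0
    simpa using HasDerivAt.comp_ofReal h1
  have hof : ∀ t : ℝ, HasDerivAt (fun t : ℝ => (t:ℂ)) 1 t := by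
    intro t
    exact HasDerivAt.comp_ofReal (hasDerivAt_id (t:ℂ))
  have hder : ∀ t : ℝ, 0 ≤ t → t ≤ 1 → HasDerivAt (fun t : ℝ => (t:ℂ) * g (t * z0))
      (g (t * z0) + t * (deriv g (t * z0) * z0)) t := by
    intro t h1 h2
    have hd : HasDerivAt g (deriv g (t * z0)) (t * z0) :=
      (hg.differentiableAt (Metric.isOpen_ball.mem_nhds (hmem t h1 h2))).hasDerivAt
    have := (hof t).mul (HasDerivAt.comp (h₂ := g) t hd (hinner t))
    rw [one_mul] at this
    exact this
  have hN : ∀ t : ℝ, 0 ≤ t → t ≤ 1 → HasDerivAt (fun t : ℝ => ‖(t:ℂ) * g (t * z0)‖ ^ 2)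
      (2 * inner ℝ ((t:ℂ) * g (t * z0)) (g (t * z0) + t * (deriv g (t * z0) * z0))) t := by
    intro t h1 h2
    exact (hder t h1 h2).norm_sq
  have hmono : MonotoneOn (fun t : ℝ => ‖(t:ℂ) * g (t * z0)‖ ^ 2) (Set.Icc 0 1) := by
    refine monotoneOn_of_deriv_nonneg (convex_Icc 0 1) ?_ ?_ ?_
    · intro t ht
      exact (hN t ht.1 ht.2).continuousAt.continuousWithinAt
    · intro t ht
      rw [interior_Icc] at ht
      exact (hN t ht.1.le ht.2.le).differentiableAt.differentiableWithinAt
    · intro t ht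
      rw [interior_Icc] at ht
      rw [(hN t ht.1.le ht.2.le).deriv]
      have hh := h t ht.1 ht.2
      by_cases hgt : g (t * z0) = 0
      · simp [hgt]
      · have e : inner ℝ ((t:ℂ) * g (t * z0)) (g (t * z0) + t * (deriv g (t * z0) * z0))
            = t * normSq (g (t * z0)) * (1 + (t * z0) * deriv g (t * z0) / g (t * z0)).re := by
          have e1 : g (t * z0) + t * (deriv g (t * z0) * z0)
            = g (t * z0) * (1 + (t * z0) * deriv g (t * z0) / g (t * z0)) := by
            field_simp
          rw [e1, Complex.inner]
          generalize (1 + (t * z0) * deriv g (t * z0) / g (t * z0)) = w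
          generalize g (t * z0) = v
          simp [normSq_apply]
          ring
        rw [e]
        have := normSq_nonneg (g (t * z0))
        have := ht.1
        positivity
  have hzero : ∀ t : ℝ, 0 < t → t ≤ 1 → g (t * z0) = 0 := by
    intro t h1 h2
    have := hmono ⟨h1.le, h2⟩ ⟨zero_le_one, le_rfl⟩ h2
    simp [hgz] at this
    exact this.resolve_left h1.ne'
  apply h0
  have hc : ContinuousAt g 0 := (hg.differentiableAt (Metric.isOpen_ball.mem_nhds (by simp))).continuousAt
  have ht : Filter.Tendsto (fun t : ℝ => (t:ℂ) * z0) (𝓝[>] 0) (𝓝 0) := by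
    have := (hinner 0).continuousAt.tendsto
    simp only [ofReal_zero, zero_mul] at this
    exact this.mono_left nhdsWithin_le_nhds
  have hI : Set.Ioo (0:ℝ) 1 ∈ 𝓝[>] (0:ℝ) := Ioo_mem_nhdsGT (by norm_num)
  refine tendsto_nhds_unique (hc.tendsto.comp ht) (tendsto_const_nhds.congr' ?_)
  filter_upwards [hI] with t ht
  exact (hzero t ht.1 ht.2.le).symm

lemma arg_sector_fwd (η : ℝ) (w : ℂ) (hw : w ≠ 0)
    (h : |w.arg| < Real.pi * η / 2) (e : ℝ) (he : |e| ≤ (1 - η) * Real.pi / 2) :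
    0 < (cexp (e * I) * w).re := by
  have e1 : cexp (e * I) * w = (‖w‖:ℂ) * cexp (((w.arg + e : ℝ) : ℂ) * I) := by
    conv_lhs => rw [← norm_mul_exp_arg_mul_I w]
    push_cast
    rw [add_mul, Complex.exp_add]; ring
  rw [e1, re_ofReal_mul, exp_ofReal_mul_I_re]
  rw [abs_lt] at h
  rw [abs_le] at he
  have := norm_pos_iff.2 hw
  have h3 := Real.cos_pos_of_mem_Ioo (x := w.arg + e) ⟨by linarith [h.1, he.1], by linarith [h.2, he.2]⟩
  positivity

lemma arg_sector_bwd (η : ℝ) (hη0 : 0 < η) (hη1 : η ≤ 1) (w : ℂ) 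
    (hre : 0 < w.re)
    (h : ∀ e : ℝ, |e| ≤ (1 - η) * Real.pi / 2 → 0 < (cexp (e * I) * w).re) :
    |w.arg| < Real.pi * η / 2 := by
  have hw : w ≠ 0 := by rintro rfl; simp at hre
  have hpi := Real.pi_pos
  have harg := abs_lt.1 (abs_arg_lt_pi_div_two_iff.2 (Or.inl hre))
  have key : ∀ e : ℝ, |e| ≤ (1 - η) * Real.pi / 2 → 0 < Real.cos (w.arg + e) := by
    intro e he
    have h1 := h e he
    have e1 : cexp (e * I) * w = (‖w‖:ℂ) * cexp (((w.arg + e : ℝ) : ℂ) * I) := by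
      conv_lhs => rw [← norm_mul_exp_arg_mul_I w]
      push_cast
      rw [add_mul, Complex.exp_add]; ring
    rw [e1, re_ofReal_mul, exp_ofReal_mul_I_re] at h1
    exact pos_of_mul_pos_right h1 (norm_nonneg _)
  have hθ : 0 ≤ (1 - η) * Real.pi / 2 := by
    have : 0 ≤ 1 - η := by linarith
    positivity
  have hθ2 : (1 - η) * Real.pi / 2 ≤ Real.pi / 2 := by nlinarith
  rw [abs_lt]
  constructor
  · by_contra hc
    push Not at hc
    have h1 := key (-((1 - η) * Real.pi / 2)) (by rw [abs_neg, abs_of_nonneg hθ])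
    rw [← Real.cos_neg] at h1
    have := Real.cos_nonpos_of_pi_div_two_le_of_le (x := -(w.arg + -((1 - η) * Real.pi / 2)))
      (by linarith) (by linarith [harg.1])
    linarith
  · by_contra hc
    push Not at hc
    have h1 := key ((1 - η) * Real.pi / 2) (by rw [abs_of_nonneg hθ])
    have := Real.cos_nonpos_of_pi_div_two_le_of_le (x := (w.arg + ((1 - η) * Real.pi / 2)))
      (by linarith) (by linarith [harg.2])
    linarith

lemma deriv_p (c lam : ℝ) (hc : 0 ≤ c) (g h : ℂ → ℂ) (hg : DifferentiableOn ℂ g unitDisk)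
    (hh : DifferentiableOn ℂ h unitDisk)
    (hR : ∀ z ∈ unitDisk, z * deriv g z + (1 + c) * g z = (c + 1) * h z)
    (z : ℂ) (hz : z ∈ unitDisk) (hgz : g z ≠ 0) (hhz : h z ≠ 0) :
    ∃ p' : ℂ, HasDerivAt (fun w => 1 + w * deriv g w / g w - (lam : ℂ)) p' z ∧
      1 + z * deriv h z / h z - (lam : ℂ)
        = (1 + z * deriv g z / g z - (lam : ℂ)) +
          z * p' / ((1 + z * deriv g z / g z - (lam : ℂ)) + lam + c) := by
  have hU : unitDisk ∈ 𝓝 z := Metric.isOpen_ball.mem_nhds hz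
  have hg1 : HasDerivAt g (deriv g z) z := (hg.differentiableAt hU).hasDerivAt
  have hh1 : HasDerivAt h (deriv h z) z := (hh.differentiableAt hU).hasDerivAt
  have hg2 : HasDerivAt (deriv g) (deriv (deriv g) z) z :=
    ((hg.deriv Metric.isOpen_ball).differentiableAt hU).hasDerivAt
  have hder : HasDerivAt (fun w => w * deriv g w + (1 + c) * g w)
      (1 * deriv g z + z * deriv (deriv g) z + (1 + c) * deriv g z) z :=
    ((hasDerivAt_id z).mul hg2).add (hg1.const_mul _)
  have hder2 : HasDerivAt (fun w => w * deriv g w + (1 + c) * g w) ((c + 1) * deriv h z) z := by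
    refine (hh1.const_mul ((c:ℂ) + 1)).congr_of_eventuallyEq ?_
    filter_upwards [hU] with w hw using hR w hw
  have e2 := hder.unique hder2
  have e1 := hR z hz
  refine ⟨_, ((((hasDerivAt_id z).mul hg2).div hg1 hgz).const_add 1).sub_const (lam : ℂ), ?_⟩
  have hc1 : (c:ℂ) + 1 ≠ 0 := by
    have : (c:ℝ) + 1 ≠ 0 := by linarith
    exact_mod_cast this
  have e3 : (1 + z * deriv g z / g z - (lam : ℂ)) + lam + c = (c + 1) * h z / g z := by
    rw [← e1]; field_simp; ring
  rw [e3]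
  have hh' : deriv h z = (1 * deriv g z + z * deriv (deriv g) z + (1 + c) * deriv g z) / (c + 1) := by
    rw [e2]; field_simp
  have e4 : h z = (z * deriv g z + (1 + c) * g z) / (c + 1) := by
    rw [e1]; field_simp
  have hX : z * deriv g z + (1 + c) * g z ≠ 0 := by
    rw [e1]; exact mul_ne_zero hc1 hhz
  rw [hh', e4]
  simp only [id, Pi.mul_apply]
  generalize deriv (deriv g) z = g2 at *
  generalize deriv g z = g1 at *
  generalize g z = g0 at *
  clear hh' e4 e3 hder hder2 e2 e1 hR
  field_simp
  ring

lemma bad_contra (P q q' m k z0 : ℂ) (hP : 0 < (k * P).re) (hq : (k * q).re = 0)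
    (h1 : (z0 * (k * q')).im = 0) (h2 : (z0 * (k * q')).re ≤ 0) (hm : 0 ≤ m.re)
    (e : P = q + z0 * q' / m) : False := by
  have e1 : k * P = k * q + (z0 * (k * q')) * m⁻¹ := by
    rw [e, div_eq_mul_inv]; ring
  rw [e1, add_re, hq, mul_re, h1, inv_re] at hP
  have h3 : 0 ≤ m.re / normSq m := div_nonneg hm (normSq_nonneg _)
  nlinarith

lemma core1 (c lam : ℝ) (hlam0 : 0 ≤ lam) (hlam1 : lam < 1) (hc : 0 ≤ c) (g h : ℂ → ℂ)
    (hg : DifferentiableOn ℂ g unitDisk)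
    (hh : DifferentiableOn ℂ h unitDisk)
    (hR : ∀ z ∈ unitDisk, z * deriv g z + (1 + c) * g z = (c + 1) * h z)
    (g0 : g 0 = 1) (hhz : ∀ z ∈ unitDisk, h z ≠ 0)
    (hP : ∀ z ∈ unitDisk, 0 < (1 + z * deriv h z / h z - (lam : ℂ)).re) :
    ∀ z ∈ unitDisk, g z ≠ 0 ∧ 0 < (1 + z * deriv g z / g z - (lam : ℂ)).re := by
  have hg' : DifferentiableOn ℂ (deriv g) unitDisk := hg.deriv Metric.isOpen_ball
  have ueq : ∀ z, g z ≠ 0 → ((g z + z * deriv g z - lam * g z) * conj (g z)).re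
      = normSq (g z) * (1 + z * deriv g z / g z - (lam : ℂ)).re := by
    intro z hz
    have : g z + z * deriv g z - lam * g z = g z * (1 + z * deriv g z / g z - (lam : ℂ)) := by
      field_simp
    rw [this, mul_comm (g z), mul_assoc, mul_conj, re_mul_ofReal, mul_comm]
  have main := first_bad (fun z => ((g z + z * deriv g z - lam * g z) * conj (g z)).re) ?_ ?_ ?_
  · intro z hz
    have hz1 := main z hz
    have hgz : g z ≠ 0 := by
      intro h0
      simp [h0] at hz1
    rw [ueq z hgz] at hz1
    exact ⟨hgz, pos_of_mul_pos_right hz1 (normSq_nonneg _)⟩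
  · apply Complex.continuous_re.comp_continuousOn
    have a := hg.continuousOn
    have b := hg'.continuousOn
    exact ((a.add (continuousOn_id.mul b)).sub (continuousOn_const.mul a)).mul
      (continuous_conj.comp_continuousOn a)
  · simp [g0]; exact hlam1
  · intro z0 hz0 hz0n hpos heq hnn
    have hz0' : ‖z0‖ < 1 := by simpa [unitDisk] using hz0
    have hgz0 : g z0 ≠ 0 := by
      refine ray g hg (by rw [g0]; exact one_ne_zero) z0 hz0 ?_
      intro t ht0 ht1
      have hlt : ‖(t:ℂ) * z0‖ < ‖z0‖ := by
        rw [norm_mul, norm_real, Real.norm_of_nonneg ht0.le]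
        have := norm_pos_iff.2 hz0n
        nlinarith
      have h1 := hpos _ hlt
      have hgz : g (t * z0) ≠ 0 := by
        intro h0
        simp [h0] at h1
      have h1' := h1
      rw [ueq _ hgz] at h1'
      have h2 := pos_of_mul_pos_right h1' (normSq_nonneg _)
      rw [sub_re, ofReal_re] at h2
      linarith
    obtain ⟨p', hp', e⟩ := deriv_p c lam hc g h hg hh hR z0 hz0 hgz0 (hhz z0 hz0)
    rw [ueq _ hgz0] at heq
    have hre0 : (1 + z0 * deriv g z0 / g z0 - (lam : ℂ)).re = 0 := by
      rcases mul_eq_zero.1 heq with h1 | h1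
      · exact absurd (normSq_eq_zero.1 h1) hgz0
      · exact h1
    have hcont : ContinuousAt g z0 := hg.continuousOn.continuousAt (Metric.isOpen_ball.mem_nhds hz0)
    have ht := touch _ p' z0 hp' (by
      filter_upwards [hcont.eventually_ne hgz0] with z hz hle
      have h1 := hnn z hle
      rw [ueq _ hz] at h1
      exact nonneg_of_mul_nonneg_right h1 (normSq_pos.2 hz)) hre0
    refine bad_contra _ _ p' _ 1 z0 (by simpa using hP z0 hz0) (by simpa using hre0)
      (by simpa using ht.1) (by simpa using ht.2) ?_ e
    rw [add_re, add_re, hre0, ofReal_re, ofReal_re]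
    linarith

lemma core2 (c lam : ℝ) (hlam0 : 0 ≤ lam) (hlam1 : lam < 1) (hc : 0 ≤ c) (g h : ℂ → ℂ)
    (hg : DifferentiableOn ℂ g unitDisk)
    (hh : DifferentiableOn ℂ h unitDisk)
    (hR : ∀ z ∈ unitDisk, z * deriv g z + (1 + c) * g z = (c + 1) * h z)
    (hhz : ∀ z ∈ unitDisk, h z ≠ 0) (k : ℂ) (hk : 0 < k.re)
    (hP : ∀ z ∈ unitDisk, 0 < (k * (1 + z * deriv h z / h z - (lam : ℂ))).re)
    (hp : ∀ z ∈ unitDisk, g z ≠ 0 ∧ 0 < (1 + z * deriv g z / g z - (lam : ℂ)).re) :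
    ∀ z ∈ unitDisk, 0 < (k * (1 + z * deriv g z / g z - (lam : ℂ))).re := by
  refine first_bad (fun z => (k * (1 + z * deriv g z / g z - (lam : ℂ))).re) ?_ ?_ ?_
  · intro z hz
    obtain ⟨p', hp', e⟩ := deriv_p c lam hc g h hg hh hR z hz (hp z hz).1 (hhz z hz)
    have := (hp'.const_mul k).continuousAt
    exact (Complex.continuous_re.continuousAt.comp this).continuousWithinAt
  · have : (1:ℂ) - lam = ((1 - lam : ℝ) : ℂ) := by push_cast; rfl
    simp only [zero_mul, zero_div, add_zero]
    rw [this, re_mul_ofReal]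
    exact mul_pos hk (by linarith)
  · intro z0 hz0 hz0n hpos heq hnn
    obtain ⟨p', hp', e⟩ := deriv_p c lam hc g h hg hh hR z0 hz0 (hp z0 hz0).1 (hhz z0 hz0)
    have ht := touch _ _ z0 (hp'.const_mul k) (Filter.Eventually.of_forall hnn) heq
    refine bad_contra _ _ p' _ k z0 (hP z0 hz0) heq ht.1 ht.2 ?_ e
    have := (hp z0 hz0).2
    rw [add_re, add_re, ofReal_re, ofReal_re]
    linarith

lemma Iop_memA (σ : ℝ) (f : ℂ → ℂ) (hf : memA f) : memA (Iop σ f) := by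
  set b : ℕ → ℂ := fun n => (((2 / ((n : ℝ) + 3)) ^ σ : ℝ) : ℂ) *
      (iteratedDeriv (n + 2) f 0 / ((n + 2).factorial : ℂ)) with hb
  have hS : DifferentiableOn ℂ (fun z => ∑' n : ℕ, b n * z ^ n) unitDisk := by
    intro z0 hz0
    have hz0' : ‖z0‖ < 1 := by simpa [unitDisk] using hz0
    obtain ⟨r, hr1, hr2⟩ := exists_between hz0'
    obtain ⟨R, hR1, hR2⟩ := exists_between hr2
    have hr0 : 0 < r := lt_of_le_of_lt (norm_nonneg _) hr1
    have hR0 : 0 < R := hr0.trans hR1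
    -- bounded coefficients
    have hsum := Complex.hasSum_taylorSeries_on_ball (c := 0) (r := 1) (f := f) (z := (R:ℂ))
      (by simpa [unitDisk] using hf.1) (by simp [abs_of_pos hR0, hR2])
    have htend := hsum.summable.tendsto_atTop_zero
    obtain ⟨M, hM⟩ := (htend.norm.bddAbove_range)
    have hM' : ∀ n : ℕ, ‖iteratedDeriv n f 0 / (n.factorial : ℂ)‖ * R ^ n ≤ M := by
      intro n
      have := hM ⟨n, rfl⟩
      simp only [sub_zero, smul_eq_mul, norm_mul, norm_inv, norm_pow, norm_real,
        Real.norm_of_nonneg hR0.le] at this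
      rw [norm_div]
      refine le_trans (le_of_eq ?_) this
      ring
    obtain ⟨k, hk⟩ := exists_nat_ge |σ|
    have hcoef : ∀ n : ℕ, (2 / ((n : ℝ) + 3)) ^ σ ≤ ((n:ℝ) + 3) ^ k := by
      intro n
      have hn : (0:ℝ) ≤ n := n.cast_nonneg
      have h1 : (2 / ((n : ℝ) + 3)) ^ σ = (((n:ℝ) + 3) / 2) ^ (-σ) := by
        rw [Real.rpow_neg (by positivity), ← Real.inv_rpow (by positivity), inv_div]
      rw [h1]
      calc (((n:ℝ) + 3) / 2) ^ (-σ) ≤ (((n:ℝ) + 3) / 2) ^ (k:ℝ) :=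
            Real.rpow_le_rpow_of_exponent_le (by linarith) (le_trans (neg_le_abs σ) hk)
        _ = (((n:ℝ) + 3) / 2) ^ k := Real.rpow_natCast _ _
        _ ≤ _ := by gcongr; linarith
    have hu : Summable (fun n : ℕ => (M / R ^ 2) * (((n:ℝ) + 3) ^ k * (r / R) ^ n)) := by
      apply Summable.mul_left
      have hq : r / R < 1 := (div_lt_one hR0).2 hR1
      have h1 := summable_pow_mul_geometric_of_norm_lt_one (R := ℝ) k (r := r / R)
        (by rw [Real.norm_of_nonneg (by positivity)]; exact hq)
      have h2 := ((summable_nat_add_iff 3).2 h1).mul_left ((r / R)⁻¹ ^ 3)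
      refine h2.congr ?_
      intro n
      push_cast
      have : r / R ≠ 0 := by positivity
      rw [pow_add]
      field_simp
    have hd := Complex.differentiableOn_tsum_of_summable_norm (F := fun n z => b n * z ^ n)
      (U := Metric.ball 0 r) hu
      (fun n => by fun_prop) Metric.isOpen_ball (by
        intro n w hw
        have hw' : ‖w‖ ≤ r := by
          have : ‖w‖ < r := by simpa using hw
          exact this.le
        have h1 := hM' (n + 2)
        have h2 : ‖iteratedDeriv (n + 2) f 0 / ((n + 2).factorial : ℂ)‖ ≤ M / R ^ (n + 2) := by
          rwa [le_div_iff₀ (by positivity)]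
        have h3 : (0:ℝ) ≤ (2 / ((n : ℝ) + 3)) ^ σ := by positivity
        have hM0 : 0 ≤ M := le_trans (by positivity) h1
        simp only [hb, norm_mul, norm_pow, norm_real]
        rw [Real.norm_of_nonneg h3]
        calc _ ≤ (((n:ℝ) + 3) ^ k * (M / R ^ (n + 2))) * r ^ n := by
              have := hcoef n
              gcongr
          _ = _ := by rw [pow_add, div_pow]; field_simp)
    exact (hd.differentiableAt (Metric.isOpen_ball.mem_nhds (by simpa using hr1))).differentiableWithinAt
  have hF : Iop σ f = fun z => z + z ^ 2 * ∑' n : ℕ, b n * z ^ n := by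
    funext z
    simp only [Iop]
    rw [← tsum_mul_left]
    congr 1
    refine tsum_congr fun n => ?_
    simp only [hb]
    ring
  rw [hF]
  refine ⟨?_, by simp, ?_⟩
  · exact differentiableOn_id.add ((differentiableOn_id.pow 2).mul hS)
  · have h0 := (hS.differentiableAt (Metric.isOpen_ball.mem_nhds (by simp : (0:ℂ) ∈ Metric.ball (0:ℂ) 1))).hasDerivAt
    have h1 := (hasDerivAt_id (0:ℂ)).add (((hasDerivAt_id (0:ℂ)).pow 2).mul h0)
    have h2 := h1.deriv
    simp at h2
    exact h2

lemma Lop_props (c : ℝ) (hc : 0 ≤ c) (F : ℂ → ℂ) (hF : DifferentiableOn ℂ F unitDisk)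
    (F0 : F 0 = 0) : DifferentiableOn ℂ (Lop c F) unitDisk ∧
      ∀ z ∈ unitDisk, z * deriv (Lop c F) z + c * Lop c F z = (c + 1) * F z := by
  set H := dslope F 0 with hHdef
  have hH : DifferentiableOn ℂ H unitDisk :=
    (Complex.differentiableOn_dslope (Metric.isOpen_ball.mem_nhds (by simp))).2 hF
  have hH' : DifferentiableOn ℂ (deriv H) unitDisk := hH.deriv Metric.isOpen_ball
  have hFH : ∀ w, F w = w * H w := by
    intro w
    have := sub_smul_dslope F 0 w
    simp [F0] at this
    exact this.symm
  have hmem : ∀ t : ℝ, 0 ≤ t → t ≤ 1 → ∀ z, ∀ r < 1, ‖z‖ ≤ r → (t:ℂ) * z ∈ Metric.closedBall (0:ℂ) r := by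
    intro t h1 h2 z r hr hz
    simp only [mem_closedBall_zero_iff, norm_mul, norm_real, Real.norm_of_nonneg h1]
    nlinarith [norm_nonneg z]
  have hsub : ∀ r < 1, Metric.closedBall (0:ℂ) r ⊆ unitDisk := by
    intro r hr z hz
    simp [unitDisk] at hz ⊢
    linarith
  have hcpow : Continuous (fun s : ℝ => ((s ^ c : ℝ) : ℂ)) :=
    continuous_ofReal.comp (Real.continuous_rpow_const hc)
  have hcomp : ∀ (K : ℂ → ℂ), ContinuousOn K unitDisk → ∀ z ∈ unitDisk,
      ContinuousOn (fun s : ℝ => K ((s:ℂ) * z)) (Set.Icc 0 1) := by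
    intro K hK z hz
    have hz' : ‖z‖ < 1 := by simpa [unitDisk] using hz
    refine hK.comp (by fun_prop) ?_
    intro s hs
    exact hsub _ hz' (hmem s hs.1 hs.2 z _ hz' le_rfl)
  have hder : ∀ z ∈ unitDisk, HasDerivAt (fun z => ∫ s in (0:ℝ)..1, ((s ^ c : ℝ) : ℂ) * H ((s:ℂ) * z))
      (∫ s in (0:ℝ)..1, ((s ^ c : ℝ) : ℂ) * (deriv H ((s:ℂ) * z) * s)) z := by
    intro z hz
    have hz' : ‖z‖ < 1 := by simpa [unitDisk] using hz
    obtain ⟨r, hr1, hr2⟩ := exists_between hz'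
    obtain ⟨M, hM⟩ := (isCompact_closedBall (0:ℂ) r).exists_bound_of_continuousOn
      (hH'.continuousOn.mono (hsub r hr2))
    have hc0 : ∀ x ∈ unitDisk, ContinuousOn (fun s : ℝ => ((s ^ c : ℝ) : ℂ) * H ((s:ℂ) * x)) (Set.Icc 0 1) :=
      fun x hx => hcpow.continuousOn.mul (hcomp H hH.continuousOn x hx)
    have hc1 : ContinuousOn (fun s : ℝ => ((s ^ c : ℝ) : ℂ) * (deriv H ((s:ℂ) * z) * s)) (Set.Icc 0 1) :=
      hcpow.continuousOn.mul ((hcomp _ hH'.continuousOn z hz).mul continuous_ofReal.continuousOn)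
    refine (intervalIntegral.hasDerivAt_integral_of_dominated_loc_of_deriv_le
      (F := fun z (s:ℝ) => ((s ^ c : ℝ) : ℂ) * H ((s:ℂ) * z))
      (F' := fun z (s:ℝ) => ((s ^ c : ℝ) : ℂ) * (deriv H ((s:ℂ) * z) * s))
      (s := Metric.ball 0 r) (bound := fun _ => M)
      (Metric.isOpen_ball.mem_nhds (by simpa using hr1)) ?_ ?_ ?_ ?_ ?_ ?_).2
    · filter_upwards [Metric.isOpen_ball.mem_nhds hz] with x hx
      rw [Set.uIoc_of_le zero_le_one]
      exact ((hc0 x hx).mono Set.Ioc_subset_Icc_self).aestronglyMeasurable measurableSet_Ioc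
    · apply ContinuousOn.intervalIntegrable
      rw [Set.uIcc_of_le zero_le_one]
      exact hc0 z hz
    · rw [Set.uIoc_of_le zero_le_one]
      exact (hc1.mono Set.Ioc_subset_Icc_self).aestronglyMeasurable measurableSet_Ioc
    · refine Filter.Eventually.of_forall fun s hs x hx => ?_
      rw [Set.uIoc_of_le zero_le_one] at hs
      have hx' : ‖x‖ < r := by simpa using hx
      have h1 := hM _ (hmem s hs.1.le hs.2 x r hr2 hx'.le)
      have hM0 : 0 ≤ M := le_trans (norm_nonneg _) h1
      rw [norm_mul, norm_mul, norm_real, norm_real, Real.norm_of_nonneg hs.1.le,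
        Real.norm_of_nonneg (Real.rpow_nonneg hs.1.le c)]
      have h2 : s ^ c ≤ 1 := Real.rpow_le_one hs.1.le hs.2 hc
      have h3 := Real.rpow_nonneg hs.1.le c
      calc s ^ c * (‖deriv H (s * x)‖ * s) ≤ 1 * (M * 1) := by
            have := hs.1.le
            have := hs.2
            gcongr
        _ = M := by ring
    · exact intervalIntegrable_const
    · refine Filter.Eventually.of_forall fun s hs x hx => ?_
      rw [Set.uIoc_of_le zero_le_one] at hs
      have hx' : ‖x‖ < r := by simpa using hx
      have hm := hsub r hr2 (hmem s hs.1.le hs.2 x r hr2 hx'.le)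
      have hd : HasDerivAt H (deriv H (s * x)) (s * x) :=
        (hH.differentiableAt (Metric.isOpen_ball.mem_nhds hm)).hasDerivAt
      have hi : HasDerivAt (fun x : ℂ => (s:ℂ) * x) s x := by
        simpa using (hasDerivAt_id x).const_mul (s:ℂ)
      exact (HasDerivAt.comp (h₂ := H) x hd hi).const_mul _
  have hL : Lop c F = fun z => ((c:ℂ) + 1) * (z * ∫ s in (0:ℝ)..1, ((s ^ c : ℝ) : ℂ) * H ((s:ℂ) * z)) := by
    funext z
    simp only [Lop]
    congr 1
    rw [← intervalIntegral.integral_const_mul]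
    refine intervalIntegral.integral_congr_ae (Filter.Eventually.of_forall fun s hs => ?_)
    rw [Set.uIoc_of_le zero_le_one] at hs
    rw [hFH, Real.rpow_sub_one hs.1.ne']
    have : (s:ℂ) ≠ 0 := by exact_mod_cast hs.1.ne'
    push_cast
    field_simp
  have hLd : ∀ z ∈ unitDisk, HasDerivAt (Lop c F) (((c:ℂ) + 1) *
      (1 * (∫ s in (0:ℝ)..1, ((s ^ c : ℝ) : ℂ) * H ((s:ℂ) * z)) +
        z * (∫ s in (0:ℝ)..1, ((s ^ c : ℝ) : ℂ) * (deriv H ((s:ℂ) * z) * s)))) z := by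
    intro z hz
    rw [hL]
    exact ((hasDerivAt_id z).mul (hder z hz)).const_mul _
  refine ⟨fun z hz => (hLd z hz).differentiableAt.differentiableWithinAt, ?_⟩
  intro z hz
  have hz' : ‖z‖ < 1 := by simpa [unitDisk] using hz
  rw [(hLd z hz).deriv, hL, hFH]
  have hi0 : IntervalIntegrable (fun s : ℝ => ((s ^ c : ℝ) : ℂ) * H ((s:ℂ) * z)) volume 0 1 := by
    apply ContinuousOn.intervalIntegrable
    rw [Set.uIcc_of_le zero_le_one]
    exact hcpow.continuousOn.mul (hcomp H hH.continuousOn z hz)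
  have hi1 : IntervalIntegrable (fun s : ℝ => ((s ^ c : ℝ) : ℂ) * (deriv H ((s:ℂ) * z) * s)) volume 0 1 := by
    apply ContinuousOn.intervalIntegrable
    rw [Set.uIcc_of_le zero_le_one]
    exact hcpow.continuousOn.mul ((hcomp _ hH'.continuousOn z hz).mul continuous_ofReal.continuousOn)
  have key : ((c:ℂ) + 1) * (∫ s in (0:ℝ)..1, ((s ^ c : ℝ) : ℂ) * H ((s:ℂ) * z)) +
        z * (∫ s in (0:ℝ)..1, ((s ^ c : ℝ) : ℂ) * (deriv H ((s:ℂ) * z) * s)) = H z := by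
    rw [← intervalIntegral.integral_const_mul, ← intervalIntegral.integral_const_mul,
      ← intervalIntegral.integral_add (hi0.const_mul _) (hi1.const_mul _)]
    have := intervalIntegral.integral_eq_sub_of_hasDerivAt (a := 0) (b := 1)
      (f := fun s : ℝ => ((s ^ (c + 1) : ℝ) : ℂ) * H ((s:ℂ) * z))
      (f' := fun s : ℝ => ((c:ℂ) + 1) * (((s ^ c : ℝ) : ℂ) * H ((s:ℂ) * z)) +
        z * (((s ^ c : ℝ) : ℂ) * (deriv H ((s:ℂ) * z) * s))) ?_
        ((hi0.const_mul _).add (hi1.const_mul _))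
    · rw [this]
      simp [Real.zero_rpow (by linarith : c + 1 ≠ 0)]
    · intro s hs
      rw [Set.uIcc_of_le zero_le_one] at hs
      have hm := hsub _ hz' (hmem s hs.1 hs.2 z _ hz' le_rfl)
      have hd : HasDerivAt H (deriv H (s * z)) (s * z) :=
        (hH.differentiableAt (Metric.isOpen_ball.mem_nhds hm)).hasDerivAt
      have hi : HasDerivAt (fun t : ℝ => (t:ℂ) * z) z s := by
        have h1 : HasDerivAt (fun t : ℂ => t * z) (1 * z) (s:ℂ) :=
          (hasDerivAt_id _).mul_const z
        simpa using HasDerivAt.comp_ofReal h1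
      have hp : HasDerivAt (fun t : ℝ => ((t ^ (c + 1) : ℝ) : ℂ)) (((c + 1) * s ^ (c + 1 - 1) : ℝ) : ℂ) s :=
        (Real.hasDerivAt_rpow_const (Or.inr (by linarith))).ofReal_comp
      have h2 := hp.mul (HasDerivAt.comp (h₂ := H) s hd hi)
      refine h2.congr_deriv ?_
      have e : s ^ (c + 1) = s ^ c * s := Real.rpow_add_one' hs.1 (by linarith)
      rw [e]
      simp only [add_sub_cancel_right, Function.comp]
      push_cast
      ring
  linear_combination ((c:ℂ) + 1) * z * key

lemma final_main
    (c lam η σ : ℝ) (hlam0 : 0 ≤ lam) (hlam1 : lam < 1)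
    (hη0 : 0 < η) (hη1 : η ≤ 1) (hclam : lam ≤ c)
    (f : ℂ → ℂ) (hf : memA f)
    (hne : ∀ z ∈ unitDisk,
      deriv (fun w => w * deriv (Lop c (Iop σ f)) w) z
        / deriv (Lop c (Iop σ f)) z ≠ (lam : ℂ))
    (hCV : CVsigma σ η lam f) :
    CVc c η lam (Iop σ f) := by
  have hA := Iop_memA σ f hf
  refine ⟨hA, ?_, hne⟩
  obtain ⟨-, hS, hN⟩ := hCV
  set F := Iop σ f with hFdef
  obtain ⟨hFd, hF0, hF1⟩ := hA
  have hc : 0 ≤ c := hlam0.trans hclam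
  obtain ⟨hGd, hGF⟩ := Lop_props c hc F hFd hF0
  set G := Lop c F with hGdef
  have hFd' : DifferentiableOn ℂ (deriv F) unitDisk := hFd.deriv Metric.isOpen_ball
  have hGd' : DifferentiableOn ℂ (deriv G) unitDisk := hGd.deriv Metric.isOpen_ball
  have hnb : ∀ z ∈ unitDisk, unitDisk ∈ 𝓝 z := fun z hz => Metric.isOpen_ball.mem_nhds hz
  have h0U : (0:ℂ) ∈ unitDisk := by simp [unitDisk]
  have hR : ∀ z ∈ unitDisk, z * deriv (deriv G) z + (1 + c) * deriv G z = (c + 1) * deriv F z := by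
    intro z hz
    have hg := (hGd.differentiableAt (hnb z hz)).hasDerivAt
    have hg' := (hGd'.differentiableAt (hnb z hz)).hasDerivAt
    have hf' := (hFd.differentiableAt (hnb z hz)).hasDerivAt
    have h1 : HasDerivAt (fun w => w * deriv G w + c * G w)
      (1 * deriv G z + z * deriv (deriv G) z + c * deriv G z) z :=
      ((hasDerivAt_id z).mul hg').add (hg.const_mul _)
    have h2 : HasDerivAt (fun w => w * deriv G w + c * G w) ((c + 1) * deriv F z) z := by
      refine (hf'.const_mul ((c:ℂ) + 1)).congr_of_eventuallyEq ?_
      filter_upwards [hnb z hz] with w hw using hGF w hw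
    have := h1.unique h2
    linear_combination this
  have hc1 : (c:ℂ) + 1 ≠ 0 := by
    have : (c:ℝ) + 1 ≠ 0 := by linarith
    exact_mod_cast this
  have hG1 : deriv G 0 = 1 := by
    have := hR 0 h0U
    rw [hF1] at this
    apply mul_left_cancel₀ hc1
    linear_combination this
  have hPne : ∀ z ∈ unitDisk, 1 + z * deriv (deriv F) z / deriv F z - (lam : ℂ) ≠ 0 := by
    intro z hz h0
    by_cases hFz : deriv F z = 0
    · rw [hFz] at h0
      simp only [div_zero, add_zero] at h0
      have : (1:ℝ) - lam = 0 := by exact_mod_cast h0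
      linarith
    · apply hN z hz
      have hf' := (hFd'.differentiableAt (hnb z hz)).hasDerivAt
      have h1 : HasDerivAt (fun w => w * deriv F w) (1 * deriv F z + z * deriv (deriv F) z) z :=
        (hasDerivAt_id z).mul hf'
      rw [h1.deriv, add_div, one_mul, div_self hFz]
      exact sub_eq_zero.1 h0
  have hPk : ∀ e : ℝ, |e| ≤ (1 - η) * Real.pi / 2 → ∀ z ∈ unitDisk,
      0 < (cexp (e * I) * (1 + z * deriv (deriv F) z / deriv F z - (lam : ℂ))).re :=
    fun e he z hz => arg_sector_fwd η _ (hPne z hz) (hS z hz) e he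
  have hpi := Real.pi_pos
  have hθ : 0 ≤ (1 - η) * Real.pi / 2 := by
    have : 0 ≤ 1 - η := by linarith
    positivity
  have hP : ∀ z ∈ unitDisk, 0 < (1 + z * deriv (deriv F) z / deriv F z - (lam : ℂ)).re := by
    intro z hz
    simpa using hPk 0 (by simpa using hθ) z hz
  have hFne : ∀ z ∈ unitDisk, deriv F z ≠ 0 := by
    intro z hz
    refine ray _ hFd' (by rw [hF1]; exact one_ne_zero) z hz ?_
    intro t ht0 ht1
    have hm : (t:ℂ) * z ∈ unitDisk := by
      have hz' : ‖z‖ < 1 := by simpa [unitDisk] using hz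
      simp only [unitDisk, mem_ball_zero_iff, norm_mul, norm_real, Real.norm_of_nonneg ht0.le]
      nlinarith [norm_nonneg z]
    have := hP _ hm
    rw [sub_re, ofReal_re] at this
    linarith
  have hp := core1 c lam hlam0 hlam1 hc (deriv G) (deriv F) hGd' hFd' hR hG1 hFne hP
  intro z hz
  refine arg_sector_bwd η hη0 hη1 _ (hp z hz).2 ?_
  intro e he
  refine core2 c lam hlam0 hlam1 hc (deriv G) (deriv F) hGd' hFd' hR hFne _ ?_ (hPk e he) hp z hz
  rw [exp_ofReal_mul_I_re]
  have he' := abs_le.1 he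
  have : (1 - η) * Real.pi / 2 < Real.pi / 2 := by nlinarith
  exact Real.cos_pos_of_mem_Ioo ⟨by linarith [he'.1], by linarith [he'.2]⟩

theorem CV_sigma_implies_Iop_mem_CV_c
    (c lam η σ : ℝ) (hc : -1 < c) (hlam0 : 0 ≤ lam) (hlam1 : lam < 1)
    (hη0 : 0 < η) (hη1 : η ≤ 1) (hclam : lam ≤ c)
    (f : ℂ → ℂ) (hf : memA f)
    (hne : ∀ z ∈ unitDisk,
      deriv (fun w => w * deriv (Lop c (Iop σ f)) w) z
        / deriv (Lop c (Iop σ f)) z ≠ (lam : ℂ))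
    (hCV : CVsigma σ η lam f) :
    CVc c η lam (Iop σ f) := by
  exact final_main c lam η σ hlam0 hlam1 hη0 hη1 hclam f hf hne hCV
end
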